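/- For an Inc(ℕ)-invariant ideal chain J∘ in R, the following are equivalent: (1) I(J∘) is bounded above; (2) the set of initial ideal chains {in_⪯(J∘) | ⪯ an Inc(ℕ)-compatible term order on R} is finite. -/

import Mathlib

open MvPolynomial

/-- The ambient polynomial ring `R = K[x_{i,j} | i ∈ [c], j ∈ ℕ]`
(second variable indices are written `0`-based). -/
abbrev PolyR (K : Type*) [Field K] (c : ℕ) : Type _ := MvPolynomial (Fin c × ℕ) K

/-- The action of `p : ℕ → ℕ` on variable indices: `x_{i,j} ↦ x_{i,p(j)}`. -/
def incVar (c : ℕ) (p : ℕ → ℕ) : Fin c × ℕ → Fin c × ℕ := fun v => (v.1, p v.2)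

/-- The `K`-linear (in fact `K`-algebra) action of `p : ℕ → ℕ` on `R`. -/
noncomputable def incAct (K : Type*) [Field K] (c : ℕ) (p : ℕ → ℕ) :
    PolyR K c →ₐ[K] PolyR K c := rename (incVar c p)

/-- `Inc(ℕ)_{m,n}`: strictly increasing maps sending the first `m` variable indices
into the first `n` variable indices. -/
def IncIn (m n : ℕ) : Set (ℕ → ℕ) := {p | StrictMono p ∧ ∀ j < m, p j < n}

/-- `R_A`: the polynomials using only variables `x_{i,j}` with `j ∈ A`. -/
def RsetOn (K : Type*) [Field K] (c : ℕ) (A : Set ℕ) : Set (PolyR K c) :=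
  (supported K {v : Fin c × ℕ | v.2 ∈ A} : Subalgebra K (PolyR K c))

/-- `R_n`: the polynomials using only the first `n` variable indices. -/
def Rset (K : Type*) [Field K] (c n : ℕ) : Set (PolyR K c) := RsetOn K c {j | j < n}

/-- `J` is an ideal of the subring of `R` with underlying set `A`. -/
def IsIdealOf {K : Type*} [Field K] {c : ℕ} (J A : Set (PolyR K c)) : Prop :=
  J ⊆ A ∧ (0 : PolyR K c) ∈ J ∧ (∀ f ∈ J, ∀ g ∈ J, f + g ∈ J) ∧
    ∀ a ∈ A, ∀ f ∈ J, a * f ∈ J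

/-- The ideal of the subring of `R` with underlying set `A` generated by `S`. -/
def spanIn {K : Type*} [Field K] {c : ℕ} (A S : Set (PolyR K c)) : Set (PolyR K c) :=
  ⋂₀ {J : Set (PolyR K c) | IsIdealOf J A ∧ S ⊆ J}

/-- The set `Inc(ℕ)_{m,n} · S`. -/
def incOrbit (K : Type*) [Field K] (c m n : ℕ) (S : Set (PolyR K c)) : Set (PolyR K c) :=
  {g | ∃ p ∈ IncIn m n, ∃ f ∈ S, g = incAct K c p f}

/-- An `Inc(ℕ)`-invariant ideal chain in `R`. -/
def IsIncChain (K : Type*) [Field K] (c : ℕ) (J : ℕ → Set (PolyR K c)) : Prop :=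
  (∀ n, IsIdealOf (J n) (Rset K c n)) ∧
    ∀ m n, m ≤ n → incOrbit K c m n (J m) ⊆ J n

/-- The set of indices from which on the chain `J` is generated by `Inc(ℕ)`-shifts. -/
def stabSet (K : Type*) [Field K] (c : ℕ) (J : ℕ → Set (PolyR K c)) : Set ℕ :=
  {N | ∀ n, N ≤ n → spanIn (Rset K c n) (incOrbit K c N n (J N)) = J n}

/-- The stability index `Ind(J∘)` of an ideal chain. -/
noncomputable def Ind (K : Type*) [Field K] (c : ℕ) (J : ℕ → Set (PolyR K c)) : ℕ :=
  sInf (stabSet K c J)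

/-- A term order: a total order on monomials (identified with their exponent vectors,
so that multiplication of monomials becomes addition) which respects multiplication and
has the monomial `1` (exponent vector `0`) as least element. -/
structure TermOrder (σ : Type*) where
  le : (σ →₀ ℕ) → (σ →₀ ℕ) → Prop
  refl : ∀ a, le a a
  trans : ∀ a b c, le a b → le b c → le a c
  antisymm : ∀ a b, le a b → le b a → a = b
  total : ∀ a b, le a b ∨ le b a
  add_right : ∀ a b h, le a b → le (a + h) (b + h)
  zero_le : ∀ a, le 0 a

/-- A term order on `R` is `Inc(ℕ)`-compatible if it is preserved by the action of every
strictly increasing map. -/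
def IncCompatible (c : ℕ) (T : TermOrder (Fin c × ℕ)) : Prop :=
  ∀ p : ℕ → ℕ, StrictMono p → ∀ a b, T.le a b →
    T.le (Finsupp.mapDomain (incVar c p) a) (Finsupp.mapDomain (incVar c p) b)

/-- `a` is the exponent vector of the leading monomial of `f` with respect to `T`. -/
def IsLeadMon {K : Type*} [Field K] {c : ℕ} (T : TermOrder (Fin c × ℕ))
    (f : PolyR K c) (a : (Fin c × ℕ) →₀ ℕ) : Prop :=
  a ∈ f.support ∧ ∀ b ∈ f.support, T.le b a

/-- The set of leading monomials of the nonzero elements of `J`. -/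
def leadMonSet (K : Type*) [Field K] (c : ℕ) (T : TermOrder (Fin c × ℕ))
    (J : Set (PolyR K c)) : Set (PolyR K c) :=
  {g | ∃ f ∈ J, f ≠ 0 ∧ ∃ a, IsLeadMon T f a ∧ g = monomial a (1 : K)}

/-- The initial ideal of `J`, as an ideal of `R_A`. -/
def initialOn (K : Type*) [Field K] (c : ℕ) (T : TermOrder (Fin c × ℕ)) (A : Set ℕ)
    (J : Set (PolyR K c)) : Set (PolyR K c) :=
  spanIn (RsetOn K c A) (leadMonSet K c T J)

/-- The chain of initial ideals `in_T(J_1) ⊆ in_T(J_2) ⊆ ...`. -/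
def inChain (K : Type*) [Field K] (c : ℕ) (T : TermOrder (Fin c × ℕ))
    (J : ℕ → Set (PolyR K c)) : ℕ → Set (PolyR K c) :=
  fun n => initialOn K c T {j | j < n} (J n)

/-- `I(J∘)`: the set of stability indices of initial ideal chains of `J` with respect to
`Inc(ℕ)`-compatible term orders. -/
def IndSet (K : Type*) [Field K] (c : ℕ) (J : ℕ → Set (PolyR K c)) : Set ℕ :=
  {N | ∃ T : TermOrder (Fin c × ℕ), IncCompatible c T ∧ Ind K c (inChain K c T J) = N}

/-- `S_n`: bijections of the variable indices fixing all indices outside the first `n`. -/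
def SymN (n : ℕ) : Set (ℕ → ℕ) := {σ | Function.Bijective σ ∧ ∀ i, n ≤ i → σ i = i}

/-- An `S_∞`-invariant ideal chain in `R`. -/
def IsSymChain (K : Type*) [Field K] (c : ℕ) (J : ℕ → Set (PolyR K c)) : Prop :=
  (∀ n, IsIdealOf (J n) (Rset K c n)) ∧
    ∀ m n, m ≤ n → ∀ σ ∈ SymN n, ∀ f ∈ J m, incAct K c σ f ∈ J n

/-- The exponent vectors of monomials in `R_n`. -/
def expSet (c n : ℕ) : Set ((Fin c × ℕ) →₀ ℕ) := {a | ∀ v ∈ a.support, v.2 < n}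

/-- The exponent vectors of the leading monomials of the nonzero elements of `J`. -/
def leadExp (K : Type*) [Field K] (c : ℕ) (T : TermOrder (Fin c × ℕ)) (J : Set (PolyR K c)) :
    Set ((Fin c × ℕ) →₀ ℕ) := {a | ∃ f ∈ J, f ≠ 0 ∧ IsLeadMon T f a}

section ExponentVectors

variable {c n : ℕ}

theorem add_mem_expSet {a b : (Fin c × ℕ) →₀ ℕ} (ha : a ∈ expSet c n) (hb : b ∈ expSet c n) :
    a + b ∈ expSet c n := by
  classical
  intro v hv
  rcases Finset.mem_union.1 (Finsupp.support_add hv) with h | h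
  exacts [ha v h, hb v h]

theorem mem_expSet_of_le {a b : (Fin c × ℕ) →₀ ℕ} (hb : b ∈ expSet c n) (h : a ≤ b) :
    a ∈ expSet c n :=
  fun v hv => hb v (Finsupp.support_mono h hv)

theorem exists_lt_le_of_mem_expSet (f : ℕ → (Fin c × ℕ) →₀ ℕ) (hf : ∀ k, f k ∈ expSet c n) :
    ∃ i j, i < j ∧ f i ≤ f j := by
  obtain ⟨i, j, hij, h⟩ :=
    wellQuasiOrdered_le (fun k => fun v : Fin c × Fin n => f k (v.1, (v.2 : ℕ)))
  refine ⟨i, j, hij, fun v => ?_⟩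
  by_cases hv : v.2 < n
  · exact h (v.1, ⟨v.2, hv⟩)
  · have : f i v = 0 := by
      by_contra h0
      exact hv (hf i v (Finsupp.mem_support_iff.2 h0))
    rw [this]
    exact Nat.zero_le _

theorem TermOrder.le_of_le {σ : Type*} (T : TermOrder σ) {a b : σ →₀ ℕ} (h : a ≤ b) :
    T.le a b := by
  have := T.add_right 0 (b - a) a (T.zero_le _)
  rwa [zero_add, tsub_add_cancel_of_le h] at this

theorem TermOrder.wellFoundedOn_expSet (T : TermOrder (Fin c × ℕ)) :
    (expSet c n).WellFoundedOn fun a b => T.le a b ∧ a ≠ b := by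
  rw [Set.WellFoundedOn, wellFounded_iff_isEmpty_descending_chain]
  refine ⟨fun ⟨f, hf⟩ => ?_⟩
  obtain ⟨i, j, hij, h⟩ := exists_lt_le_of_mem_expSet (fun k => (f k : (Fin c × ℕ) →₀ ℕ))
    fun k => (f k).2
  have hlt : ∀ i j, i < j → T.le (f j) (f i) ∧ (f j : (Fin c × ℕ) →₀ ℕ) ≠ f i := by
    intro i j hij
    induction j, hij using Nat.le_induction with
    | base => exact hf i
    | succ j _ ih =>
      have hj := hf j
      refine ⟨T.trans _ _ _ hj.1 ih.1, fun he => hj.2 (T.antisymm _ _ hj.1 ?_)⟩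
      rw [he]
      exact ih.1
  exact (hlt i j hij).2 (T.antisymm _ _ (hlt i j hij).1 (T.le_of_le h))

end ExponentVectors

section Ideals

variable {K : Type*} [Field K] {c n : ℕ}

theorem mem_Rset_iff {f : PolyR K c} :
    f ∈ Rset K c n ↔ ∀ a ∈ f.support, a ∈ expSet c n := by
  rw [Rset, RsetOn, SetLike.mem_coe, mem_supported]
  constructor
  · intro h a ha v hv
    exact h ((mem_vars_iff_mem_support v).2 ⟨a, ha, hv⟩)
  · intro h v hv
    obtain ⟨a, ha, hv⟩ := (mem_vars_iff_mem_support v).1 hv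
    exact h a ha v hv

theorem monomial_mem_Rset {a : (Fin c × ℕ) →₀ ℕ} (ha : a ∈ expSet c n) (r : K) :
    monomial a r ∈ Rset K c n :=
  mem_Rset_iff.2 fun b hb => by
    rw [Finset.mem_singleton.1 (support_monomial_subset hb)]
    exact ha

theorem isIdealOf_RsetOn (A : Set ℕ) : IsIdealOf (RsetOn K c A) (RsetOn K c A) :=
  ⟨subset_rfl, Subalgebra.zero_mem _, fun _ hf _ hg => Subalgebra.add_mem _ hf hg,
    fun _ ha _ hf => Subalgebra.mul_mem _ ha hf⟩

theorem subset_spanIn (A S : Set (PolyR K c)) : S ⊆ spanIn A S :=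
  Set.subset_sInter fun _ h => h.2

theorem spanIn_subset {A S I : Set (PolyR K c)} (hI : IsIdealOf I A) (h : S ⊆ I) :
    spanIn A S ⊆ I :=
  Set.sInter_subset_of_mem ⟨hI, h⟩

theorem isIdealOf_spanIn {A : Set ℕ} {S : Set (PolyR K c)} (h : S ⊆ RsetOn K c A) :
    IsIdealOf (spanIn (RsetOn K c A) S) (RsetOn K c A) :=
  ⟨spanIn_subset (isIdealOf_RsetOn A) h, fun _ hI => hI.1.2.1,
    fun f hf g hg I hI => hI.1.2.2.1 f (hf I hI) g (hg I hI),
    fun a ha f hf I hI => hI.1.2.2.2 a ha f (hf I hI)⟩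

end Ideals

section LeadingMonomials

variable {K : Type*} [Field K] {c n : ℕ} {T : TermOrder (Fin c × ℕ)} {J : Set (PolyR K c)}

theorem leadMonSet_eq_image (T : TermOrder (Fin c × ℕ)) (J : Set (PolyR K c)) :
    leadMonSet K c T J = (fun a => monomial a (1 : K)) '' leadExp K c T J := by
  ext g
  constructor
  · rintro ⟨f, hf, h0, a, ha, rfl⟩
    exact ⟨a, ⟨f, hf, h0, ha⟩, rfl⟩
  · rintro ⟨a, ⟨f, hf, h0, ha⟩, rfl⟩
    exact ⟨f, hf, h0, a, ha, rfl⟩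

theorem exists_isLeadMon (T : TermOrder (Fin c × ℕ)) {f : PolyR K c} (hf : f ≠ 0) :
    ∃ a, IsLeadMon T f a := by
  have key : ∀ s : Finset ((Fin c × ℕ) →₀ ℕ), s.Nonempty → ∃ a ∈ s, ∀ b ∈ s, T.le b a := by
    intro s hs
    induction hs using Finset.Nonempty.cons_induction with
    | singleton a => exact ⟨a, by simp, by simpa using T.refl a⟩
    | cons a s _ _ ih =>
      obtain ⟨m, hm, hmax⟩ := ih
      rcases T.total a m with h | h
      · refine ⟨m, Finset.mem_cons_of_mem hm, fun b hb => ?_⟩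
        rcases Finset.mem_cons.1 hb with rfl | hb
        exacts [h, hmax b hb]
      · refine ⟨a, Finset.mem_cons_self a s, fun b hb => ?_⟩
        rcases Finset.mem_cons.1 hb with rfl | hb
        exacts [T.refl _, T.trans _ _ _ (hmax b hb) h]
  exact key _ (support_nonempty.2 hf)

theorem leadExp_subset_expSet (hJ : IsIdealOf J (Rset K c n)) : leadExp K c T J ⊆ expSet c n := by
  rintro a ⟨f, hf, -, ha⟩
  exact mem_Rset_iff.1 (hJ.1 hf) a ha.1

theorem add_mem_leadExp (hJ : IsIdealOf J (Rset K c n)) {a d : (Fin c × ℕ) →₀ ℕ}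
    (ha : a ∈ leadExp K c T J) (hd : d ∈ expSet c n) : d + a ∈ leadExp K c T J := by
  obtain ⟨f, hf, h0, ha, hmax⟩ := ha
  have hmem : d + a ∈ (monomial d (1 : K) * f).support := by
    rw [mem_support_iff, coeff_monomial_mul, one_mul]
    exact mem_support_iff.1 ha
  refine ⟨monomial d 1 * f, hJ.2.2.2 _ (monomial_mem_Rset hd 1) f hf,
    support_nonempty.1 ⟨_, hmem⟩, hmem, fun b hb => ?_⟩
  rw [mem_support_iff, coeff_monomial_mul'] at hb
  split_ifs at hb with hdb
  · have := T.add_right _ _ d (hmax (b - d) (mem_support_iff.2 (by simpa using hb)))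
    rwa [tsub_add_cancel_of_le hdb, add_comm a d] at this
  · exact absurd rfl hb

theorem mem_leadExp_of_le (hJ : IsIdealOf J (Rset K c n)) {a b : (Fin c × ℕ) →₀ ℕ}
    (ha : a ∈ leadExp K c T J) (hb : b ∈ expSet c n) (hab : a ≤ b) : b ∈ leadExp K c T J := by
  have := add_mem_leadExp hJ ha (mem_expSet_of_le hb tsub_le_self : b - a ∈ expSet c n)
  rwa [tsub_add_cancel_of_le hab] at this

/-- An ideal of `R_n` as a `K`-subspace of `R`. -/
def IsIdealOf.toSubmodule (hJ : IsIdealOf J (Rset K c n)) : Submodule K (PolyR K c) where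
  carrier := J
  zero_mem' := hJ.2.1
  add_mem' hf hg := hJ.2.2.1 _ hf _ hg
  smul_mem' r f hf := by
    rw [smul_eq_C_mul]
    exact hJ.2.2.2 _ (monomial_mem_Rset (a := 0) (by simp [expSet]) r) f hf

/-- The standard monomials span `R_n` modulo `J`. -/
theorem monomial_mem_sup_restrictSupport (T : TermOrder (Fin c × ℕ))
    (hJ : IsIdealOf J (Rset K c n)) {a : (Fin c × ℕ) →₀ ℕ} (ha : a ∈ expSet c n) (r : K) :
    monomial a r ∈ hJ.toSubmodule ⊔ restrictSupport K (leadExp K c T J)ᶜ := by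
  refine T.wellFoundedOn_expSet.induction (P := fun a => ∀ r : K, monomial a r ∈
    hJ.toSubmodule ⊔ restrictSupport K (leadExp K c T J)ᶜ) ha (fun a ha ih r => ?_) r
  by_cases hM : a ∈ leadExp K c T J
  · obtain ⟨f, hf, -, hfa, hmax⟩ := hM
    have hsum : monomial a (coeff a f) = f - ∑ b ∈ f.support.erase a, monomial b (coeff b f) := by
      rw [eq_sub_iff_add_eq, Finset.add_sum_erase _ (fun b => monomial b (coeff b f)) hfa]
      exact support_sum_monomial_coeff f
    have hmem : monomial a (coeff a f) ∈
        hJ.toSubmodule ⊔ restrictSupport K (leadExp K c T J)ᶜ := by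
      rw [hsum]
      refine Submodule.sub_mem _ (Submodule.mem_sup_left hf) (Submodule.sum_mem _ fun b hb => ?_)
      have hb' := Finset.mem_erase.1 hb
      exact ih b (mem_Rset_iff.1 (hJ.1 hf) b hb'.2) ⟨hmax b hb'.2, hb'.1⟩ _
    have := Submodule.smul_mem _ (r * (coeff a f)⁻¹) hmem
    rwa [smul_monomial, smul_eq_mul, inv_mul_cancel_right₀ (mem_support_iff.1 hfa)] at this
  · exact Submodule.mem_sup_right ((monomial_mem_restrictSupport K).2 (Or.inl hM))

/-- Every leading monomial is the only nonstandard monomial of some element of `J`. -/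
theorem exists_reduced (hJ : IsIdealOf J (Rset K c n)) {a : (Fin c × ℕ) →₀ ℕ}
    (ha : a ∈ leadExp K c T J) :
    ∃ f ∈ J, f ≠ 0 ∧ ∀ b ∈ f.support, b = a ∨ b ∉ leadExp K c T J := by
  obtain ⟨f, hf, r, hr, hfr⟩ := Submodule.mem_sup.1
    (monomial_mem_sup_restrictSupport T hJ (leadExp_subset_expSet hJ ha) 1)
  rw [mem_restrictSupport_iff] at hr
  have hfe : f = monomial a 1 - r := eq_sub_of_add_eq hfr
  refine ⟨f, hf, ?_, fun b hb => ?_⟩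
  · rintro rfl
    rw [zero_add] at hfr
    refine hr (?_ : a ∈ (r.support : Set _)) ha
    simp [hfr]
  · by_contra! h
    have hb0 : coeff b r = 0 := by
      by_contra h0
      exact hr (mem_support_iff.2 h0) h.2
    rw [mem_support_iff, hfe, coeff_sub, coeff_monomial, if_neg (Ne.symm h.1), hb0, sub_zero] at hb
    exact hb rfl

theorem leadExp_eq_of_subset {T' : TermOrder (Fin c × ℕ)} (hJ : IsIdealOf J (Rset K c n))
    (h : leadExp K c T J ⊆ leadExp K c T' J) : leadExp K c T J = leadExp K c T' J := by
  refine h.antisymm fun a ha => ?_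
  by_contra hna
  obtain ⟨f, hf, h0, hsupp⟩ := exists_reduced hJ ha
  obtain ⟨b, hb⟩ := exists_isLeadMon T h0
  have hbM : b ∈ leadExp K c T J := ⟨f, hf, h0, hb⟩
  rcases hsupp b hb.1 with rfl | hn
  exacts [hna hbM, hn (h hbM)]

theorem finite_setOf_leadExp (hJ : IsIdealOf J (Rset K c n)) :
    {M | ∃ T : TermOrder (Fin c × ℕ), leadExp K c T J = M}.Finite := by
  let P : Type _ := {U : Set ((Fin c × ℕ) →₀ ℕ) // U ⊆ expSet c n ∧
    ∀ a ∈ U, ∀ b ∈ expSet c n, a ≤ b → b ∈ U}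
  have hwf : WellFounded fun U V : P => V.1 ⊂ U.1 := by
    rw [wellFounded_iff_isEmpty_descending_chain]
    refine ⟨fun ⟨f, hf⟩ => ?_⟩
    choose a ha hna using fun k => Set.exists_of_ssubset (hf k)
    have hmono : Monotone fun k => (f k).1 := monotone_nat_of_le_succ fun k => (hf k).subset
    obtain ⟨i, j, hij, hle⟩ := exists_lt_le_of_mem_expSet a fun k => (f (k + 1)).2.1 (ha k)
    exact hna j ((f j).2.2 _ (hmono (Nat.succ_le_of_lt hij) (ha i)) _ ((f (j + 1)).2.1 (ha j)) hle)
  have key : ∀ U : P, {M | (∃ T : TermOrder (Fin c × ℕ), leadExp K c T J = M) ∧ U.1 ⊆ M}.Finite := by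
    intro U
    induction U using hwf.induction with
    | _ U ih =>
      by_cases hex : ∃ T : TermOrder (Fin c × ℕ), U.1 ⊂ leadExp K c T J
      · obtain ⟨T, hT⟩ := hex
        obtain ⟨a, haT, haU⟩ := Set.exists_of_ssubset hT
        obtain ⟨f, hf, h0, hsupp⟩ := exists_reduced hJ haT
        have hfU : ∀ b ∈ f.support, b ∉ U.1 := by
          intro b hb hbU
          rcases hsupp b hb with rfl | h
          exacts [haU hbU, h (hT.subset hbU)]
        let V (b : (Fin c × ℕ) →₀ ℕ) : P := ⟨U.1 ∪ {d | d ∈ expSet c n ∧ b ≤ d},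
          Set.union_subset U.2.1 fun d hd => hd.1, by
            rintro d (hd | hd) e he hde
            · exact Or.inl (U.2.2 d hd e he hde)
            · exact Or.inr ⟨he, hd.2.trans hde⟩⟩
        have hUV : ∀ b ∈ f.support, U.1 ⊂ (V b).1 := fun b hb =>
          Set.ssubset_iff_subset_ne.2 ⟨Set.subset_union_left, fun h => hfU b hb (by
            rw [h]
            exact Or.inr ⟨mem_Rset_iff.1 (hJ.1 hf) b hb, le_rfl⟩)⟩
        refine (Set.Finite.biUnion f.support.finite_toSet fun b hb => ih (V b) (hUV b hb)).subset ?_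
        rintro _ ⟨⟨T', rfl⟩, hUM⟩
        obtain ⟨b, hb⟩ := exists_isLeadMon T' h0
        refine Set.mem_biUnion (Finset.mem_coe.2 hb.1) ⟨⟨T', rfl⟩, Set.union_subset hUM ?_⟩
        exact fun d hd => mem_leadExp_of_le hJ ⟨f, hf, h0, hb⟩ hd.1 hd.2
      · refine (Set.finite_singleton U.1).subset ?_
        rintro _ ⟨⟨T', rfl⟩, hUM⟩
        by_contra hne
        exact hex ⟨T', Set.ssubset_iff_subset_ne.2 ⟨hUM, fun h => hne h.symm⟩⟩
  refine (key ⟨∅, Set.empty_subset _, fun a ha => ha.elim⟩).subset fun M hM => ?_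
  exact ⟨hM, Set.empty_subset _⟩

theorem finite_setOf_initialOn (hJ : IsIdealOf J (Rset K c n)) :
    {L | ∃ T : TermOrder (Fin c × ℕ), initialOn K c T {j | j < n} J = L}.Finite := by
  refine ((finite_setOf_leadExp hJ).image fun M =>
    spanIn (RsetOn K c {j | j < n}) ((fun a => monomial a (1 : K)) '' M)).subset ?_
  rintro _ ⟨T, rfl⟩
  exact ⟨_, ⟨T, rfl⟩, by rw [initialOn, leadMonSet_eq_image]⟩

end LeadingMonomials

section Stabilization

variable {K : Type*} [Field K] {c : ℕ} {T : TermOrder (Fin c × ℕ)} {J : ℕ → Set (PolyR K c)}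

theorem incVar_injective {p : ℕ → ℕ} (hp : StrictMono p) : Function.Injective (incVar c p) := by
  rintro ⟨i, j⟩ ⟨i', j'⟩ h
  simp only [incVar, Prod.mk.injEq] at h ⊢
  exact ⟨h.1, hp.injective h.2⟩

theorem mapDomain_incVar_comp (p q : ℕ → ℕ) (a : (Fin c × ℕ) →₀ ℕ) :
    Finsupp.mapDomain (incVar c (p ∘ q)) a =
      Finsupp.mapDomain (incVar c p) (Finsupp.mapDomain (incVar c q) a) := by
  rw [← Finsupp.mapDomain_comp]
  rfl

theorem mapDomain_incVar_mono (p : ℕ → ℕ) {a b : (Fin c × ℕ) →₀ ℕ} (h : a ≤ b) :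
    Finsupp.mapDomain (incVar c p) a ≤ Finsupp.mapDomain (incVar c p) b := by
  rw [← tsub_add_cancel_of_le h, Finsupp.mapDomain_add]
  exact le_add_self

theorem comp_mem_IncIn {l m n : ℕ} {p q : ℕ → ℕ} (hp : p ∈ IncIn m n) (hq : q ∈ IncIn l m) :
    p ∘ q ∈ IncIn l n :=
  ⟨hp.1.comp hq.1, fun j hj => hp.2 _ (hq.2 j hj)⟩

theorem id_mem_IncIn {m n : ℕ} (h : m ≤ n) : id ∈ IncIn m n :=
  ⟨strictMono_id, fun _ hj => hj.trans_le h⟩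

theorem exists_comp_eq_of_mem_IncIn {m n : ℕ} (hmn : m ≤ n) {p : ℕ → ℕ}
    (hp : p ∈ IncIn m (n + 1)) : ∃ r ∈ IncIn n (n + 1), ∃ q ∈ IncIn m n, r ∘ q = p := by
  classical
  by_cases hid : ∃ k, k < p k
  · have hk := Nat.find_spec hid
    have hmin : ∀ j < Nat.find hid, p j = j := fun j hj =>
      le_antisymm (not_lt.1 (Nat.find_min hid hj)) (hp.1.le_apply)
    generalize Nat.find hid = k at hk hmin
    have hgt : ∀ j, k ≤ j → j < p j := fun j hj => by
      induction j, hj using Nat.le_induction with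
      | base => exact hk
      | succ j _ ih =>
        have := hp.1 (lt_add_one j)
        omega
    refine ⟨fun i => if i < k then i else i + 1, ⟨fun i j hij => ?_, fun j hj => ?_⟩,
      fun j => if j < k then j else p j - 1, ⟨fun i j hij => ?_, fun j hj => ?_⟩, ?_⟩
    · dsimp only
      split_ifs <;> omega
    · dsimp only
      split_ifs <;> omega
    · have := hp.1 hij
      have := hgt i
      have := hgt j
      dsimp only
      split_ifs <;> omega
    · have := hp.2 j hj
      have := hgt j
      dsimp only
      split_ifs <;> omega
    · funext j
      have := hgt j
      have := hmin j
      simp only [Function.comp]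
      split_ifs <;> omega
  · refine ⟨id, id_mem_IncIn (Nat.le_succ n), id, id_mem_IncIn hmn, ?_⟩
    funext j
    push Not at hid
    exact le_antisymm (hp.1.le_apply) (hid j)

theorem mapDomain_incVar_mem_leadExp (hJ : IsIncChain K c J) (hT : IncCompatible c T) {m n : ℕ}
    (hmn : m ≤ n) {p : ℕ → ℕ} (hp : p ∈ IncIn m n) {a : (Fin c × ℕ) →₀ ℕ}
    (ha : a ∈ leadExp K c T (J m)) :
    Finsupp.mapDomain (incVar c p) a ∈ leadExp K c T (J n) := by
  classical
  obtain ⟨f, hf, h0, ha, hmax⟩ := ha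
  have hinj := incVar_injective (c := c) hp.1
  refine ⟨incAct K c p f, hJ.2 m n hmn ⟨p, hp, f, hf, rfl⟩, ?_, ?_, ?_⟩
  · exact fun h => h0 (rename_injective _ hinj (h.trans (map_zero _).symm))
  · rw [incAct, support_rename_of_injective hinj]
    exact Finset.mem_image_of_mem _ ha
  · intro b hb
    rw [incAct, support_rename_of_injective hinj] at hb
    obtain ⟨d, hd, rfl⟩ := Finset.mem_image.1 hb
    exact hT p hp.1 _ _ (hmax d hd)

/-- A monomial of `R_n` as a word of length `n` over the alphabet `ℕ^c`. -/
def expWord {c : ℕ} (n : ℕ) (a : (Fin c × ℕ) →₀ ℕ) : List (Fin c → ℕ) :=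
  List.ofFn fun (j : Fin n) i => a (i, (j : ℕ))

theorem expWord_getElem? {n : ℕ} (a : (Fin c × ℕ) →₀ ℕ) {j : ℕ} (hj : j < n) :
    (expWord n a)[j]? = some fun i => a (i, j) := by
  simp [expWord, hj]

theorem exists_mapDomain_le_of_sublistForall₂ {m n : ℕ} {a b : (Fin c × ℕ) →₀ ℕ}
    (ha : a ∈ expSet c m) (h : List.SublistForall₂ (· ≤ ·) (expWord m a) (expWord n b)) :
    ∃ p ∈ IncIn m n, Finsupp.mapDomain (incVar c p) a ≤ b := by
  obtain ⟨l, hl, hsub⟩ := List.sublistForall₂_iff.1 h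
  obtain ⟨p, hp⟩ := List.sublist_iff_exists_orderEmbedding_getElem?_eq.1 hsub
  have hlen : l.length = m := by rw [← hl.length_eq, expWord, List.length_ofFn]
  have hpn : ∀ j < m, p j < n := by
    intro j hj
    have h1 := hp j
    rw [List.getElem?_eq_getElem (hlen ▸ hj)] at h1
    obtain ⟨h2, -⟩ := List.getElem?_eq_some_iff.1 h1.symm
    simpa [expWord] using h2
  refine ⟨p, ⟨p.strictMono, hpn⟩, fun v => ?_⟩
  have hinj := incVar_injective (c := c) p.strictMono
  by_cases hv : v ∈ Set.range (incVar c p)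
  · obtain ⟨⟨i, j⟩, rfl⟩ := hv
    rw [Finsupp.mapDomain_apply hinj]
    by_cases hj : j < m
    · have h1 := hp j
      rw [expWord_getElem? b (hpn j hj)] at h1
      have h2 := (List.forall₂_iff_get.1 hl).2 j (by simpa [expWord] using hj) (hlen ▸ hj)
      obtain ⟨h3, h4⟩ := List.getElem?_eq_some_iff.1 h1
      simp only [List.get_eq_getElem, h4] at h2
      have h5 : (expWord m a)[j]'(by simpa [expWord] using hj) = fun i => a (i, j) := by
        simp [expWord]
      rw [h5] at h2
      exact h2 i
    · have : a (i, j) = 0 := by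
        by_contra h0
        exact hj (ha (i, j) (Finsupp.mem_support_iff.2 h0))
      rw [this]
      exact Nat.zero_le _
  · rw [Finsupp.mapDomain_of_notMem_range _ _ hv]
    exact Nat.zero_le _

theorem exists_forall_succ_leadExp (hJ : IsIncChain K c J) (hT : IncCompatible c T) :
    ∃ N, ∀ n ≥ N, ∀ a ∈ leadExp K c T (J (n + 1)), ∃ b ∈ leadExp K c T (J n),
      ∃ r ∈ IncIn n (n + 1), Finsupp.mapDomain (incVar c r) b ≤ a := by
  by_contra! hcon
  obtain ⟨φ, hφ, hnew⟩ := Filter.extraction_of_frequently_atTop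
    (Filter.frequently_atTop.2 hcon)
  choose a ha hnew using hnew
  have hpwo := Set.PartiallyWellOrderedOn.partiallyWellOrderedOn_sublistForall₂
    ((· ≤ ·) : (Fin c → ℕ) → (Fin c → ℕ) → Prop) (s := Set.univ)
    (Set.partiallyWellOrderedOn_univ_iff.2 wellQuasiOrdered_le)
  obtain ⟨k, l, hkl, hsub⟩ := hpwo.exists_lt (f := fun k => expWord (φ k + 1) (a k))
    fun _ _ _ => Set.mem_univ _
  obtain ⟨p, hp, hle⟩ := exists_mapDomain_le_of_sublistForall₂
    (leadExp_subset_expSet (hJ.1 _) (ha k)) hsub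
  have hlt : φ k + 1 ≤ φ l := hφ hkl
  obtain ⟨r, hr, q, hq, rfl⟩ := exists_comp_eq_of_mem_IncIn hlt hp
  rw [mapDomain_incVar_comp] at hle
  exact hnew l _ (mapDomain_incVar_mem_leadExp hJ hT hlt hq (ha k)) r hr hle

theorem exists_forall_leadExp (hJ : IsIncChain K c J) (hT : IncCompatible c T) :
    ∃ N, ∀ n ≥ N, ∀ a ∈ leadExp K c T (J n), ∃ b ∈ leadExp K c T (J N),
      ∃ r ∈ IncIn N n, Finsupp.mapDomain (incVar c r) b ≤ a := by
  obtain ⟨N, hN⟩ := exists_forall_succ_leadExp hJ hT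
  refine ⟨N, fun n hn => ?_⟩
  induction n, hn using Nat.le_induction with
  | base =>
    refine fun a ha => ⟨a, ha, id, id_mem_IncIn le_rfl, le_of_eq ?_⟩
    exact Finsupp.mapDomain_id
  | succ n hn ih =>
    intro a ha
    obtain ⟨b, hb, r, hr, hle⟩ := hN n hn a ha
    obtain ⟨d, hd, q, hq, hle'⟩ := ih b hb
    refine ⟨d, hd, r ∘ q, comp_mem_IncIn hr hq, ?_⟩
    rw [mapDomain_incVar_comp]
    exact (mapDomain_incVar_mono r hle').trans hle

theorem leadMonSet_subset_Rset {n : ℕ} {I : Set (PolyR K c)} (hI : IsIdealOf I (Rset K c n)) :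
    leadMonSet K c T I ⊆ Rset K c n := by
  rw [leadMonSet_eq_image]
  rintro _ ⟨a, ha, rfl⟩
  exact monomial_mem_Rset (leadExp_subset_expSet hI ha) 1

theorem incAct_mem_Rset {m n : ℕ} {p : ℕ → ℕ} (hp : p ∈ IncIn m n) {f : PolyR K c}
    (hf : f ∈ Rset K c m) : incAct K c p f ∈ Rset K c n := by
  classical
  have hinj := incVar_injective (c := c) hp.1
  refine mem_Rset_iff.2 fun a ha v hv => ?_
  rw [incAct, support_rename_of_injective hinj] at ha
  obtain ⟨b, hb, rfl⟩ := Finset.mem_image.1 ha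
  obtain ⟨w, hw, rfl⟩ := Finset.mem_image.1 (Finsupp.mapDomain_support hv)
  exact hp.2 _ (mem_Rset_iff.1 hf b hb w hw)

theorem isIdealOf_inChain (hJ : IsIncChain K c J) (n : ℕ) :
    IsIdealOf (inChain K c T J n) (Rset K c n) :=
  isIdealOf_spanIn (leadMonSet_subset_Rset (hJ.1 n))

theorem incOrbit_inChain_subset (hJ : IsIncChain K c J) (hT : IncCompatible c T) {m n : ℕ}
    (hmn : m ≤ n) : incOrbit K c m n (inChain K c T J m) ⊆ inChain K c T J n := by
  rintro _ ⟨p, hp, f, hf, rfl⟩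
  have hn := isIdealOf_inChain (T := T) hJ n
  have hI : IsIdealOf (Rset K c m ∩ {g | incAct K c p g ∈ inChain K c T J n}) (Rset K c m) := by
    have hR := isIdealOf_RsetOn (K := K) (c := c) {j | j < m}
    refine ⟨Set.inter_subset_left, ⟨hR.2.1, ?_⟩, fun g hg h hh => ⟨hR.2.2.1 g hg.1 h hh.1, ?_⟩,
      fun g hg h hh => ⟨hR.2.2.2 g hg h hh.1, ?_⟩⟩
    · rw [Set.mem_ofPred_eq, map_zero]
      exact hn.2.1
    · rw [Set.mem_ofPred_eq, map_add]
      exact hn.2.2.1 _ hg.2 _ hh.2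
    · rw [Set.mem_ofPred_eq, map_mul]
      exact hn.2.2.2 _ (incAct_mem_Rset hp hg) _ hh.2
  refine (spanIn_subset hI (fun g hg => ⟨leadMonSet_subset_Rset (hJ.1 m) hg, ?_⟩) hf).2
  rw [leadMonSet_eq_image] at hg
  obtain ⟨a, ha, rfl⟩ := hg
  refine subset_spanIn _ _ ?_
  rw [leadMonSet_eq_image]
  refine ⟨_, mapDomain_incVar_mem_leadExp hJ hT hmn hp ha, ?_⟩
  simp [incAct, rename_monomial]

theorem stabSet_inChain_nonempty (hJ : IsIncChain K c J) (hT : IncCompatible c T) :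
    (stabSet K c (inChain K c T J)).Nonempty := by
  obtain ⟨N, hN⟩ := exists_forall_leadExp hJ hT
  refine ⟨N, fun n hn => Set.Subset.antisymm
    (spanIn_subset (isIdealOf_inChain hJ n) (incOrbit_inChain_subset hJ hT hn)) ?_⟩
  have horb : incOrbit K c N n (inChain K c T J N) ⊆ Rset K c n :=
    (incOrbit_inChain_subset hJ hT hn).trans (isIdealOf_inChain hJ n).1
  refine spanIn_subset (isIdealOf_spanIn horb) ?_
  rw [leadMonSet_eq_image]
  rintro _ ⟨a, ha, rfl⟩
  obtain ⟨b, hb, r, hr, hle⟩ := hN n hn a ha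
  have hd : a - Finsupp.mapDomain (incVar c r) b ∈ expSet c n :=
    mem_expSet_of_le (leadExp_subset_expSet (hJ.1 n) ha) tsub_le_self
  have hmon : incAct K c r (monomial b 1) ∈
      spanIn (Rset K c n) (incOrbit K c N n (inChain K c T J N)) := by
    refine subset_spanIn _ _ ⟨r, hr, _, subset_spanIn _ _ ?_, rfl⟩
    rw [leadMonSet_eq_image]
    exact ⟨b, hb, rfl⟩
  have := (isIdealOf_spanIn horb).2.2.2 _ (monomial_mem_Rset hd 1) _ hmon
  rwa [incAct, rename_monomial, monomial_mul, one_mul, tsub_add_cancel_of_le hle] at this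

theorem inChain_eq_of_le_Ind (hJ : IsIncChain K c J) (hT : IncCompatible c T) {n : ℕ}
    (hn : Ind K c (inChain K c T J) ≤ n) :
    spanIn (Rset K c n) (incOrbit K c (Ind K c (inChain K c T J)) n
      (inChain K c T J (Ind K c (inChain K c T J)))) = inChain K c T J n :=
  Nat.sInf_mem (stabSet_inChain_nonempty hJ hT) n hn

end Stabilization

/-- **Theorem (Statement 10).** For an `Inc(ℕ)`-invariant ideal chain `J∘` in `R`, the
following are equivalent: (1) `I(J∘)` is bounded above; (2) the set of initial ideal chains
`{in_⪯(J∘) | ⪯ an Inc(ℕ)-compatible term order on R}` is finite. -/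
theorem indSet_bddAbove_iff_finitely_many_inChains (K : Type*) [Field K] (c : ℕ) (hc : 0 < c)
    (J : ℕ → Set (PolyR K c)) (hJ : IsIncChain K c J) :
    BddAbove (IndSet K c J) ↔
      {L : ℕ → Set (PolyR K c) |
        ∃ T : TermOrder (Fin c × ℕ), IncCompatible c T ∧ inChain K c T J = L}.Finite := by
  constructor
  · rintro ⟨M, hM⟩
    have hfin : ((Set.Iic M) ×ˢ Set.pi Set.univ fun n : Fin (M + 1) =>
        {L | ∃ T : TermOrder (Fin c × ℕ), initialOn K c T {j | j < (n : ℕ)} (J n) = L}).Finite :=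
      (Set.finite_Iic M).prod (Set.Finite.pi fun n => finite_setOf_initialOn (hJ.1 n))
    refine Set.Finite.of_injOn (f := fun L => (Ind K c L, fun n : Fin (M + 1) => L n)) ?_ ?_ hfin
    · rintro _ ⟨T, hT, rfl⟩
      exact ⟨hM ⟨T, hT, rfl⟩, fun n _ => ⟨T, rfl⟩⟩
    · rintro _ ⟨T, hT, rfl⟩ _ ⟨T', hT', rfl⟩ h
      obtain ⟨hInd, hL⟩ := Prod.mk.inj h
      have hle : ∀ n ≤ M, inChain K c T J n = inChain K c T' J n := fun n hn =>
        congrFun hL ⟨n, Nat.lt_succ_of_le hn⟩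
      have hIM : Ind K c (inChain K c T J) ≤ M := hM ⟨T, hT, rfl⟩
      funext n
      by_cases hn : n ≤ M
      · exact hle n hn
      · have hIn : Ind K c (inChain K c T J) ≤ n := hIM.trans (not_le.1 hn).le
        rw [← inChain_eq_of_le_Ind hJ hT hIn, ← inChain_eq_of_le_Ind hJ hT' (hInd ▸ hIn),
          ← hInd, hle _ hIM]
  · intro h
    refine ((h.image (Ind K c)).subset ?_).bddAbove
    rintro _ ⟨T, hT, rfl⟩
    exact ⟨_, ⟨T, hT, rfl⟩, rfl⟩
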